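/- Suppose K : ℝ^p ⇉ ℝ^n is continuous (both lower and upper semicontinuous) and f : ℝ^p × ℝ^n × ℝ^n → ℝ^m is C-upper semicontinuous. Then mf = ν + μ is lower semicontinuous on ℝ^p × ℝ^n, and the graph of the solution map Equi is closed. -/

import Mathlib

/- STATEMENT 2: if K is continuous (l.s.c. and u.s.c.) and f is C-u.s.c., then
   mf = ν + μ is lower semicontinuous and graph Equi is closed. -/

open Filter Topology Metric Set Pointwise ENNReal

noncomputable section

abbrev E (k : ℕ) := EuclideanSpace ℝ (Fin k)

/-- Lower semicontinuity of a set-valued map. -/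
def SVLsc {α β : Type*} [TopologicalSpace α] [TopologicalSpace β] (K : α → Set β) : Prop :=
  ∀ ξ₀ : α, ∀ V : Set β, IsOpen V → (K ξ₀ ∩ V).Nonempty →
    ∃ U ∈ 𝓝 ξ₀, ∀ ξ ∈ U, (K ξ ∩ V).Nonempty

/-- Upper semicontinuity of a set-valued map. -/
def SVUsc {α β : Type*} [PseudoMetricSpace α] [PseudoMetricSpace β] (K : α → Set β) : Prop :=
  ∀ ξ₀ : α, ∀ ε > (0 : ℝ), ∃ δ > (0 : ℝ), ∀ ξ, dist ξ ξ₀ ≤ δ →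
    ∀ x ∈ K ξ, Metric.infDist x (K ξ₀) < ε

/-- `C`-upper semicontinuity of a map `g`. -/
def CUsc {α G : Type*} [TopologicalSpace α] [AddGroup G] [TopologicalSpace G]
    (C : Set G) (g : α → G) : Prop :=
  ∀ x₀ : α, ∀ V ∈ 𝓝 (g x₀), ∃ U ∈ 𝓝 x₀, ∀ x ∈ U, g x ∈ V - C

/-- The auxiliary function ν, with values in `[0,+∞]`. -/
def nuF {p n m : ℕ} (f : E p → E n → E n → E m) (K : E p → Set (E n)) (C : Set (E m))
    (ξ : E p) (x : E n) : ℝ≥0∞ :=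
  ⨆ z ∈ K ξ, EMetric.infEdist (f ξ x z) C

/-- The auxiliary function μ, with values in `[0,+∞]`. -/
def muF {p n : ℕ} (K : E p → Set (E n)) (ξ : E p) (x : E n) : ℝ≥0∞ :=
  EMetric.infEdist x (K ξ)

/-- The auxiliary merit function mf = ν + μ. -/
def mfF {p n m : ℕ} (f : E p → E n → E n → E m) (K : E p → Set (E n)) (C : Set (E m))
    (ξ : E p) (x : E n) : ℝ≥0∞ :=
  nuF f K C ξ x + muF K ξ x

/-- The solution map of the parameterized strong vector equilibrium problem. -/
def equiSet {p n m : ℕ} (f : E p → E n → E n → E m) (K : E p → Set (E n)) (C : Set (E m))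
    (ξ : E p) : Set (E n) :=
  {x ∈ K ξ | ∀ z ∈ K ξ, f ξ x z ∈ C}

/-- A `C`-upper semicontinuous map has a lower semicontinuous distance to `C`, when `C` is stable
under addition. -/
theorem CUsc.lowerSemicontinuous_infEDist {α G : Type*} [TopologicalSpace α]
    [SeminormedAddCommGroup G] {C : Set G} {g : α → G} (hg : CUsc C g)
    (hC : ∀ a ∈ C, ∀ b ∈ C, a + b ∈ C) :
    LowerSemicontinuous (fun q => Metric.infEDist (g q) C) := by
  intro q₀ y hy
  obtain ⟨r, hr, hyr⟩ := ENNReal.lt_iff_exists_add_pos_lt.1 hy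
  obtain ⟨U, hU, hUg⟩ := hg q₀ (Metric.eball (g q₀) r) (Metric.eball_mem_nhds _ (by simpa using hr))
  filter_upwards [hU] with q hq
  obtain ⟨v, hv, c, hc, hvc⟩ := Set.mem_sub.1 (hUg q hq)
  have hshift : Metric.infEDist v C ≤ Metric.infEDist (g q) C := by
    refine Metric.le_infEDist.2 fun b hb => ?_
    refine (Metric.infEDist_le_edist_of_mem (hC b hb c hc)).trans_eq ?_
    rw [← hvc, ← edist_add_right (v - c) b c, sub_add_cancel]
  have hle : Metric.infEDist (g q₀) C ≤ Metric.infEDist (g q) C + r :=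
    Metric.infEDist_le_infEDist_add_edist.trans
      (add_le_add hshift (by rw [edist_comm]; exact (Metric.mem_eball.1 hv).le))
  exact lt_of_add_lt_add_right (hyr.trans_le hle)

/-- A supremum of a jointly lower semicontinuous function over a lower semicontinuous set-valued
map is lower semicontinuous. -/
theorem SVLsc.lowerSemicontinuous_biSup {α β γ : Type*} [TopologicalSpace α] [TopologicalSpace β]
    [TopologicalSpace γ] {K : α → Set γ} (hK : SVLsc K) {h : α × β × γ → ℝ≥0∞}
    (hh : LowerSemicontinuous h) :
    LowerSemicontinuous (fun q : α × β => ⨆ z ∈ K q.1, h (q.1, q.2, z)) := by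
  rintro ⟨ξ₀, x₀⟩ y hy
  simp only [lt_iSup_iff] at hy
  obtain ⟨z, hz, hyz⟩ := hy
  obtain ⟨A, hA, D, hD, hAD⟩ := mem_nhds_prod_iff.1 (hh (ξ₀, x₀, z) y hyz)
  obtain ⟨B, hB, V, hV, hBV⟩ := mem_nhds_prod_iff.1 hD
  obtain ⟨U, hU, hUK⟩ := hK ξ₀ (interior V) isOpen_interior ⟨z, hz, mem_interior_iff_mem_nhds.2 hV⟩
  filter_upwards [prod_mem_nhds (inter_mem hA hU) hB]
  rintro ⟨ξ, x⟩ ⟨⟨hξA, hξU⟩, hx⟩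
  obtain ⟨w, hw, hwV⟩ := hUK ξ hξU
  have hlt : y < h (ξ, x, w) := hAD ⟨hξA, hBV ⟨hx, interior_subset hwV⟩⟩
  exact hlt.trans_le (le_iSup₂ (f := fun z _ => h (ξ, x, z)) w hw)

/-- The distance to the values of an upper semicontinuous set-valued map is lower
semicontinuous. -/
theorem SVUsc.lowerSemicontinuous_infEDist {α β : Type*} [PseudoMetricSpace α]
    [PseudoMetricSpace β] {K : α → Set β} (hK : SVUsc K) (hne : ∀ ξ, (K ξ).Nonempty) :
    LowerSemicontinuous (fun q : α × β => Metric.infEDist q.2 (K q.1)) := by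
  rintro ⟨ξ₀, x₀⟩ y hy
  obtain ⟨r, hr, hyr⟩ := ENNReal.lt_iff_exists_add_pos_lt.1 hy
  obtain ⟨s, hs, hys⟩ := ENNReal.lt_iff_exists_add_pos_lt.1 hyr
  obtain ⟨δ, hδ, hKδ⟩ := hK ξ₀ r (by exact_mod_cast hr)
  filter_upwards [prod_mem_nhds (Metric.closedBall_mem_nhds ξ₀ hδ)
    (Metric.eball_mem_nhds x₀ (ε := s) (by simpa using hs))]
  rintro ⟨ξ, x⟩ ⟨hξ, hx⟩
  have hexcess : ∀ b ∈ K ξ, Metric.infEDist b (K ξ₀) ≤ r := fun b hb => by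
    have hlt := hKδ ξ hξ b hb
    rw [← ENNReal.ofReal_toReal (Metric.infEDist_ne_top (x := b) (hne ξ₀)),
      ← ENNReal.ofReal_coe_nnreal]
    exact ENNReal.ofReal_le_ofReal hlt.le
  have hle : Metric.infEDist x₀ (K ξ₀) ≤ Metric.infEDist x (K ξ) + r + s := by
    refine Metric.infEDist_le_infEDist_add_edist.trans
      (add_le_add ?_ (by rw [edist_comm]; exact (Metric.mem_eball.1 hx).le))
    rw [← tsub_le_iff_right]
    refine Metric.le_infEDist.2 fun b hb => tsub_le_iff_right.2 ?_
    rw [add_comm]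
    exact Metric.infEDist_le_infEDist_add_edist.trans (add_le_add_left (hexcess b hb) _)
  exact lt_of_add_lt_add_right (lt_of_add_lt_add_right (hys.trans_le hle))

theorem statement2 {p n m : ℕ}
    (K : E p → Set (E n)) (C : Set (E m)) (f : E p → E n → E n → E m)
    -- standing assumptions
    (hKgraph : IsClosed {q : E p × E n | q.2 ∈ K q.1})
    (hKdom : ∀ ξ : E p, (K ξ).Nonempty)
    -- C is a nontrivial closed convex pointed cone
    (hCclosed : IsClosed C) (hCconv : Convex ℝ C)
    (hCcone : ∀ c ∈ C, ∀ t : ℝ, 0 ≤ t → t • c ∈ C)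
    (hCpointed : C ∩ (-C) = {0}) (hCnontriv : C ≠ {0})
    -- (i) K is continuous (both l.s.c. and u.s.c.)
    (hKlsc : SVLsc K) (hKusc : SVUsc K)
    -- (ii) f is C-u.s.c.
    (hfusc : CUsc C (fun q : E p × E n × E n => f q.1 q.2.1 q.2.2)) :
    LowerSemicontinuous (fun q : E p × E n => mfF f K C q.1 q.2) ∧
      IsClosed {q : E p × E n | q.2 ∈ equiSet f K C q.1} := by
  have hCadd : ∀ a ∈ C, ∀ b ∈ C, a + b ∈ C := fun a ha b hb => by
    have hmid := hCcone _ (hCconv ha hb (a := 1 / 2) (b := 1 / 2) (by norm_num) (by norm_num)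
      (by norm_num)) 2 (by norm_num)
    simpa [smul_add, smul_smul] using hmid
  have hmf : LowerSemicontinuous (fun q : E p × E n => mfF f K C q.1 q.2) :=
    (hKlsc.lowerSemicontinuous_biSup (hfusc.lowerSemicontinuous_infEDist hCadd)).add
      (hKusc.lowerSemicontinuous_infEDist hKdom)
  refine ⟨hmf, ?_⟩
  have hKclosed : ∀ ξ, IsClosed (K ξ) := fun ξ =>
    hKgraph.preimage (Continuous.prodMk_right ξ)
  convert hmf.isClosed_preimage 0 using 1
  ext ⟨ξ, x⟩
  simp only [Set.mem_ofPred_eq, equiSet, Set.mem_preimage, Set.mem_Iic, nonpos_iff_eq_zero, mfF, nuF,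
    muF, add_eq_zero, ENNReal.iSup_eq_zero]
  rw [and_comm, Metric.mem_iff_infEDist_zero_of_closed (hKclosed ξ)]
  simp only [Metric.mem_iff_infEDist_zero_of_closed hCclosed]
  exact Iff.rfl
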